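/- arXiv:2311.13278 — 3 statements merged into one kernel-verified Lean document; each statement's English description precedes it below -/
import Mathlib

section
/- Fix T > 0 and integers d, n, k ≥ 1. Let C([0,T], ℝ^d) denote the space of continuous functions from [0,T] to ℝ^d with the uniform topology and its Borel σ-algebra. Let σ̃ : [0,T] × C([0,T], ℝ^d) → ℝ^{d×n} be a Borel-measurable function such that rank(σ̃(t,x)·σ̃(t,x)ᵀ) = k for every (t,x) ∈ [0,T] × C([0,T], ℝ^d). Then there exists a Borel-measurable function σ : [0,T] × C([0,T], ℝ^d) → ℝ^{d×k} such that rank(σ(t,x)) = k and σ(t,x)·σ(t,x)ᵀ = σ̃(t,x)·σ̃(t,x)ᵀ for every (t,x) ∈ [0,T] × C([0,T], ℝ^d). -/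
open MeasureTheory
open scoped Matrix

/-- The space of continuous maps carries the Borel σ-algebra of the compact-open
(uniform, for compact domain) topology. -/
instance contMapMeasurableSpace {X Y : Type*} [TopologicalSpace X] [TopologicalSpace Y] :
    MeasurableSpace C(X, Y) := borel _

/-- Matrices carry the (Borel) product σ-algebra, entrywise. -/
instance matrixMeasurableSpace {m n : Type*} {α : Type*} [MeasurableSpace α] :
    MeasurableSpace (Matrix m n α) := inferInstanceAs (MeasurableSpace (m → n → α))

theorem measurable_matrix_iff {Ω m n α : Type*} [MeasurableSpace Ω] [MeasurableSpace α]
    {M : Ω → Matrix m n α} : Measurable M ↔ ∀ i j, Measurable fun ω => M ω i j := by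
  have h : Measurable M ↔ Measurable (fun ω i j => M ω i j : Ω → m → n → α) := Iff.rfl
  simp only [h, measurable_pi_iff]

/-- Measurable selection from countably many measurable functions. -/
theorem exists_measurable_select {Ω ι β : Type*} [MeasurableSpace Ω] [MeasurableSpace β]
    [Countable ι] [Nonempty ι] {g : ι → Ω → β} (hg : ∀ i, Measurable (g i)) {p : ι → Ω → Prop}
    (hp : ∀ i, MeasurableSet {ω | p i ω}) (h : ∀ ω, ∃ i, p i ω) :
    ∃ f : Ω → β, Measurable f ∧ ∀ ω, ∃ i, p i ω ∧ f ω = g i ω := by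
  classical
  obtain ⟨e, he⟩ := exists_surjective_nat ι
  have h' : ∀ ω, ∃ N, p (e N) ω := fun ω => by
    obtain ⟨i, hi⟩ := h ω
    obtain ⟨N, rfl⟩ := he i
    exact ⟨N, hi⟩
  exact ⟨_, Measurable.find (fun N => hg (e N)) (fun N => hp (e N)) h',
    fun ω => ⟨_, Nat.find_spec (h' ω), rfl⟩⟩

/-- Projecting the rows of a matrix off the direction of a nonzero row lowers the rank. -/
theorem rank_sub_vecMulVec_lt {m n : Type*} [Fintype m] [Fintype n]
    {M : Matrix m n ℝ} {u : n → ℝ} {c : ℝ} {i : m} (hu : u = c • M i) (huu : u ⬝ᵥ u = 1) :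
    (M - Matrix.vecMulVec (M *ᵥ u) u).rank < M.rank := by
  classical
  have hmul : ∀ x, (M - Matrix.vecMulVec (M *ᵥ u) u) *ᵥ x = M *ᵥ x - (u ⬝ᵥ x) • (M *ᵥ u) := by
    intro x
    simp [Matrix.sub_mulVec, Matrix.vecMulVec_mulVec]
  have hdot : ∀ x, u ⬝ᵥ x = c * (M *ᵥ x) i := by
    intro x
    rw [hu, smul_dotProduct, smul_eq_mul]
    rfl
  have hlt : LinearMap.ker M.mulVecLin <
      LinearMap.ker (M - Matrix.vecMulVec (M *ᵥ u) u).mulVecLin := by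
    refine SetLike.lt_iff_le_and_exists.2 ⟨fun x hx => ?_, u, ?_, fun hx => ?_⟩
    · rw [LinearMap.mem_ker, Matrix.mulVecLin_apply] at hx ⊢
      simp [hmul, hdot, hx]
    · rw [LinearMap.mem_ker, Matrix.mulVecLin_apply, hmul, huu, one_smul, sub_self]
    · rw [LinearMap.mem_ker, Matrix.mulVecLin_apply] at hx
      simp [hdot, hx] at huu
  have hker := Submodule.finrank_lt_finrank_of_lt hlt
  have h₁ := LinearMap.finrank_range_add_finrank_ker M.mulVecLin
  have h₂ := LinearMap.finrank_range_add_finrank_ker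
    (M - Matrix.vecMulVec (M *ᵥ u) u).mulVecLin
  simp only [Matrix.rank]
  omega

theorem sub_vecMulVec_mul_transpose {m n : Type*} [Fintype n]
    {M : Matrix m n ℝ} {u : n → ℝ} (huu : u ⬝ᵥ u = 1) :
    (M - Matrix.vecMulVec (M *ᵥ u) u) * (M - Matrix.vecMulVec (M *ᵥ u) u)ᵀ =
      M * Mᵀ - Matrix.vecMulVec (M *ᵥ u) (M *ᵥ u) := by
  have h : u ᵥ* Mᵀ = M *ᵥ u := Matrix.vecMul_transpose M u
  rw [Matrix.transpose_sub, Matrix.transpose_vecMulVec, Matrix.sub_mul, Matrix.mul_sub,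
    Matrix.mul_sub, Matrix.mul_vecMulVec, Matrix.vecMulVec_mul, h, Matrix.vecMulVec_mul_vecMulVec,
    huu]
  simp

/-- A measurable matrix function of rank at most `k` has, pointwise, the same Gram matrix of rows
as a measurable matrix function with only `k` columns. -/
theorem exists_measurable_mul_transpose_eq {Ω m n : Type*} [MeasurableSpace Ω] [Fintype m]
    [Nonempty m] [Fintype n] (k : ℕ) {M : Ω → Matrix m n ℝ} (hM : Measurable M)
    (hrank : ∀ ω, (M ω).rank ≤ k) :
    ∃ S : Ω → Matrix m (Fin k) ℝ, Measurable S ∧ ∀ ω, S ω * (S ω)ᵀ = M ω * (M ω)ᵀ := by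
  induction k generalizing M with
  | zero =>
    refine ⟨fun _ => 0, measurable_const, fun ω => ?_⟩
    have h : M ω = 0 := by
      classical
      have hr : Module.finrank ℝ (LinearMap.range (M ω).mulVecLin) = 0 := Nat.le_zero.1 (hrank ω)
      rw [Submodule.finrank_eq_zero, LinearMap.range_eq_bot] at hr
      exact Matrix.toLin'.map_eq_zero_iff.1 hr
    simp [h]
  | succ k ih =>
    have hM' := measurable_matrix_iff.1 hM
    have hrow : ∀ i, Measurable fun ω => M ω i := fun i => measurable_pi_iff.2 (hM' i)
    have hzero : MeasurableSet {ω | M ω = 0} := by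
      have : {ω | M ω = 0} = ⋂ i, ⋂ j, {ω | M ω i j = 0} := by
        ext ω
        simp [← Matrix.ext_iff]
      rw [this]
      exact .iInter fun i => .iInter fun j => hM' i j (measurableSet_singleton 0)
    obtain ⟨u, hu, hsel⟩ := exists_measurable_select
      (g := fun i ω => (√(M ω i ⬝ᵥ M ω i))⁻¹ • M ω i)
      (p := fun i ω => M ω = 0 ∨ M ω i ≠ 0)
      (fun i => by
        refine Measurable.smul (Measurable.inv (Measurable.sqrt ?_)) (hrow i)
        exact Finset.measurable_sum _ fun j _ => (hM' i j).mul (hM' i j))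
      (fun i => hzero.union (hrow i (measurableSet_singleton 0)).compl)
      (fun ω => by
        by_cases h : M ω = 0
        · exact ⟨Classical.arbitrary m, .inl h⟩
        · obtain ⟨i, hi⟩ := Function.ne_iff.1 h
          exact ⟨i, .inr hi⟩)
    have hspec : ∀ ω, M ω = 0 ∨ u ω ⬝ᵥ u ω = 1 ∧ ∃ (c : ℝ) (i : m), u ω = c • M ω i := by
      intro ω
      obtain ⟨i, hi | hi, hui⟩ := hsel ω
      · exact .inl hi
      · refine .inr ⟨?_, _, i, hui⟩
        have hnn : 0 ≤ M ω i ⬝ᵥ M ω i := Finset.sum_nonneg fun j _ => mul_self_nonneg _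
        have hpos : M ω i ⬝ᵥ M ω i ≠ 0 := fun h => hi (dotProduct_self_eq_zero.1 h)
        rw [hui, smul_dotProduct, dotProduct_smul, smul_eq_mul, smul_eq_mul, ← mul_assoc,
          ← mul_inv, Real.mul_self_sqrt hnn, inv_mul_cancel₀ hpos]
    have hu' := measurable_pi_iff.1 hu
    have hv : ∀ i, Measurable fun ω => (M ω *ᵥ u ω) i := fun i =>
      Finset.measurable_sum _ fun j _ => (hM' i j).mul (hu' j)
    obtain ⟨S, hS, hSM⟩ := ih (M := fun ω => M ω - Matrix.vecMulVec (M ω *ᵥ u ω) (u ω))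
      (measurable_matrix_iff.2 fun i j => (hM' i j).sub ((hv i).mul (hu' j)))
      (fun ω => by
        obtain h | ⟨huu, c, i, hui⟩ := hspec ω
        · simp [h]
        · exact Nat.lt_succ_iff.1 ((rank_sub_vecMulVec_lt hui huu).trans_le (hrank ω)))
    refine ⟨fun ω => Matrix.of fun i => Fin.cons ((M ω *ᵥ u ω) i) (S ω i),
      measurable_matrix_iff.2 fun i j => ?_, fun ω => ?_⟩
    · refine Fin.cases ?_ (fun j => ?_) j
      · simpa using hv i
      · simpa using measurable_matrix_iff.1 hS i j
    · have hadd : M ω * (M ω)ᵀ = Matrix.vecMulVec (M ω *ᵥ u ω) (M ω *ᵥ u ω) + S ω * (S ω)ᵀ := by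
        rw [hSM]
        obtain h | ⟨huu, -⟩ := hspec ω
        · simp [h]
        · rw [sub_vecMulVec_mul_transpose huu, add_sub_cancel]
      rw [hadd]
      ext i j
      simp [Matrix.mul_apply, Fin.sum_univ_succ, Matrix.vecMulVec_apply]

/-- Fix `T > 0` and `d, n, k ≥ 1`.  If
`σ̃ : [0,T] × C([0,T], ℝ^d) → ℝ^{d×n}` is Borel measurable with
`rank(σ̃(t,x) σ̃(t,x)ᵀ) = k` for every `(t,x)`, then there is a Borel-measurable
`σ : [0,T] × C([0,T], ℝ^d) → ℝ^{d×k}` with `rank(σ(t,x)) = k` and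
`σ(t,x) σ(t,x)ᵀ = σ̃(t,x) σ̃(t,x)ᵀ` for every `(t,x)`. -/
theorem stmt3 (T : ℝ) (hT : 0 < T) (d n k : ℕ) (hd : 1 ≤ d) (hn : 1 ≤ n) (hk : 1 ≤ k)
    (σtil : Set.Icc (0 : ℝ) T × C(Set.Icc (0 : ℝ) T, EuclideanSpace ℝ (Fin d)) →
      Matrix (Fin d) (Fin n) ℝ)
    (hmeas : Measurable σtil)
    (hrank : ∀ p, (σtil p * (σtil p)ᵀ).rank = k) :
    ∃ σ : Set.Icc (0 : ℝ) T × C(Set.Icc (0 : ℝ) T, EuclideanSpace ℝ (Fin d)) →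
        Matrix (Fin d) (Fin k) ℝ,
      Measurable σ ∧ ∀ p, (σ p).rank = k ∧ σ p * (σ p)ᵀ = σtil p * (σtil p)ᵀ := by
  have : Nonempty (Fin d) := ⟨⟨0, hd⟩⟩
  obtain ⟨S, hS, hSM⟩ := exists_measurable_mul_transpose_eq k hmeas fun p => by
    rw [← hrank p, Matrix.rank_self_mul_transpose]
  refine ⟨S, hS, fun p => ⟨?_, hSM p⟩⟩
  rw [← Matrix.rank_self_mul_transpose, hSM, hrank]
end

section
/- Let (Ω, 𝓕, P) be a probability space, 𝓖 ⊆ 𝓕 a sub-σ-algebra, S a Polish space, W : Ω → S a 𝓖-measurable random variable, and U : Ω → ℝ an integrable random variable. Let F : S × ℝ → ℝ be Borel measurable such that for every w ∈ S the map u ↦ F(w,u) is concave, and assume that F(W,U) is P-integrable. Then E[F(W,U) | 𝓖] ≤ F(W, E[U | 𝓖]) P-almost surely; in particular, if additionally the negative part of F(W, E[U|𝓖]) is integrable, then E[F(W,U)] ≤ E[F(W, E[U | 𝓖])]. -/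
open MeasureTheory
open scoped ENNReal

/-- Conditional Jensen inequality for a concave integrand depending on the conditioning variable. -/
theorem condExp_le_of_concaveOn {Ω β : Type*} {m : MeasurableSpace Ω} [mβ : MeasurableSpace β]
    {P : Measure Ω} [IsFiniteMeasure P] {X : Ω → β} (hX : Measurable X) {U : Ω → ℝ}
    (hU : Integrable U P) {G : β → ℝ → ℝ} (hG : Measurable (fun p : β × ℝ => G p.1 p.2))
    (hconc : ∀ b, ConcaveOn ℝ Set.univ (G b)) (hint : Integrable (fun ω => G (X ω) (U ω)) P) :
    P[fun ω => G (X ω) (U ω)|mβ.comap X] ≤ᵐ[P] fun ω => G (X ω) ((P[U|mβ.comap X]) ω) := by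
  have hU' : AEMeasurable U P := hU.1.aemeasurable
  have hXU : AEMeasurable (fun ω => (X ω, U ω)) P := hX.aemeasurable.prodMk hU'
  have hU_cond := Integrable.condDistrib_ae (f := fun p : β × ℝ => p.2) hX.aemeasurable hU'
    ((integrable_map_measure measurable_snd.aestronglyMeasurable hXU).2 hU)
  have hG_cond := Integrable.condDistrib_ae hX.aemeasurable hU'
    ((integrable_map_measure hG.aestronglyMeasurable hXU).2 hint)
  filter_upwards [hU_cond, hG_cond,
    ProbabilityTheory.condExp_prod_ae_eq_integral_condDistrib hX hU' hG.stronglyMeasurable hint,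
    ProbabilityTheory.condExp_ae_eq_integral_condDistrib' hX hU] with ω h1 h2 h3 h4
  rw [h3, h4]
  exact (hconc (X ω)).le_map_integral ((hconc (X ω)).continuousOn isOpen_univ) isClosed_univ
    (by simp) h1 h2

/-- An integrable function that is a.e. at most `g` has integral at most the extended-real integral
of `g`. -/
theorem coe_integral_le_lintegral_sub_lintegral_of_ae_le {α : Type*} {m : MeasurableSpace α}
    {μ : Measure α} {f g : α → ℝ} (hf : Integrable f μ) (hfg : f ≤ᵐ[μ] g) :
    ((∫ a, f a ∂μ : ℝ) : EReal) ≤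
      ((∫⁻ a, ENNReal.ofReal (g a) ∂μ : ℝ≥0∞) : EReal) -
        ((∫⁻ a, ENNReal.ofReal (-g a) ∂μ : ℝ≥0∞) : EReal) := by
  rw [integral_eq_lintegral_pos_part_sub_lintegral_neg_part hf, EReal.coe_sub,
    EReal.coe_ennreal_toReal hf.lintegral_lt_top.ne,
    EReal.coe_ennreal_toReal hf.fun_neg.lintegral_lt_top.ne]
  refine EReal.sub_le_sub (EReal.coe_ennreal_le_coe_ennreal_iff.2 (lintegral_mono_ae ?_))
    (EReal.coe_ennreal_le_coe_ennreal_iff.2 (lintegral_mono_ae ?_))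
  · filter_upwards [hfg] with a ha using ENNReal.ofReal_le_ofReal ha
  · filter_upwards [hfg] with a ha using ENNReal.ofReal_le_ofReal (neg_le_neg ha)

/-- **conditional Jensen for a concave integrand.** Let `(Ω, 𝓕, P)` be a
probability space, `𝓖 = m₂ ⊆ 𝓕` a sub-σ-algebra, `S` a Polish space, `W : Ω → S`
`𝓖`-measurable, `U : Ω → ℝ` integrable, and `F : S × ℝ → ℝ` Borel measurable with
`u ↦ F(w, u)` concave for every `w`, and `F(W, U)` integrable.  Then
`E[F(W,U) | 𝓖] ≤ F(W, E[U | 𝓖])` a.s.; in particular, if the negative part of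
`F(W, E[U|𝓖])` is integrable, then `E[F(W,U)] ≤ E[F(W, E[U|𝓖])]`, where the right-hand
side is the extended-real integral `∫ F⁺ − ∫ F⁻ ∈ (−∞, ∞]`. -/
theorem stmt8 {Ω : Type*} {m : MeasurableSpace Ω} (P : Measure Ω) [IsProbabilityMeasure P]
    (m₂ : MeasurableSpace Ω) (hm : m₂ ≤ m)
    {S : Type*} [TopologicalSpace S] [PolishSpace S] [MeasurableSpace S] [BorelSpace S]
    (W : Ω → S) (hW : @Measurable Ω S m₂ _ W)
    (U : Ω → ℝ) (hU : Integrable U P)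
    (F : S → ℝ → ℝ) (hF : Measurable (fun p : S × ℝ => F p.1 p.2))
    (hconc : ∀ w : S, ConcaveOn ℝ Set.univ (fun u => F w u))
    (hint : Integrable (fun ω => F (W ω) (U ω)) P) :
    (∀ᵐ ω ∂P, (P[fun ω => F (W ω) (U ω)|m₂]) ω ≤ F (W ω) ((P[U|m₂]) ω)) ∧
    (Integrable (fun ω => min (F (W ω) ((P[U|m₂]) ω)) 0) P →
      ((∫ ω, F (W ω) (U ω) ∂P : ℝ) : EReal) ≤
        ((∫⁻ ω, ENNReal.ofReal (F (W ω) ((P[U|m₂]) ω)) ∂P : ℝ≥0∞) : EReal) -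
          ((∫⁻ ω, ENNReal.ofReal (-(F (W ω) ((P[U|m₂]) ω))) ∂P : ℝ≥0∞) : EReal)) := by
  have key : P[fun ω => F (W ω) (U ω)|m₂] ≤ᵐ[P] fun ω => F (W ω) ((P[U|m₂]) ω) := by
    have h := condExp_le_of_concaveOn (mβ := m₂) (X := id) (G := fun ω u => F (W ω) u)
      (measurable_id'' hm) hU (hF.comp ((hW.comp measurable_fst).prodMk measurable_snd))
      (fun ω => hconc (W ω)) hint
    simpa only [MeasurableSpace.comap_id, id] using h
  refine ⟨key, fun _ => ?_⟩
  rw [← integral_condExp hm]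
  exact coe_integral_le_lintegral_sub_lintegral_of_ae_le integrable_condExp key
end

section
/- Let X be a Polish space and let (μ_n) be a sequence of Borel probability measures on X converging weakly to a Borel probability measure μ. Let f : X → ℝ be upper semicontinuous, and assume that the positive part f⁺ := max(f, 0) is integrable with respect to μ and with respect to each μ_n, and that f⁺ is asymptotically uniformly integrable with respect to (μ_n), i.e. lim_{K→∞} limsup_{n→∞} ∫ f⁺·1_{{f⁺ > K}} dμ_n = 0. Then limsup_{n→∞} ∫ f dμ_n ≤ ∫ f dμ, where all integrals are well-defined elements of [−∞, ∞) via ∫ f dν := ∫ f⁺ dν − ∫ f⁻ dν. -/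
open MeasureTheory Filter Topology
open scoped ENNReal

/-- The portmanteau inequality for nonnegative lower semicontinuous functions. -/
lemma lintegral_le_liminf_lintegral_of_lowerSemicontinuous {X : Type*} [TopologicalSpace X]
    [MeasurableSpace X] [OpensMeasurableSpace X] {μ : Measure X} {μs : ℕ → Measure X} {g : X → ℝ}
    (hg : LowerSemicontinuous g) (g_nn : 0 ≤ g)
    (h_opens : ∀ G, IsOpen G → μ G ≤ atTop.liminf (fun i ↦ μs i G)) :
    ∫⁻ x, ENNReal.ofReal (g x) ∂μ ≤ atTop.liminf (fun i ↦ ∫⁻ x, ENNReal.ofReal (g x) ∂(μs i)) := by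
  simp_rw [lintegral_eq_lintegral_meas_lt _ (Eventually.of_forall g_nn) hg.measurable.aemeasurable]
  exact (lintegral_mono fun t ↦ h_opens _ (hg.isOpen_preimage t)).trans
    (lintegral_liminf_le fun n ↦ Antitone.measurable fun s t hst ↦
      measure_mono fun ω hω ↦ lt_of_le_of_lt hst hω)

/-- Weak convergence, tested on bounded continuous functions, bounds the measure of open sets. -/
lemma measure_le_liminf_of_forall_tendsto_integral {X : Type*} [TopologicalSpace X]
    [MeasurableSpace X] [OpensMeasurableSpace X] [HasOuterApproxClosed X]
    {μn : ℕ → Measure X} {μ : Measure X}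
    [∀ i, IsProbabilityMeasure (μn i)] [IsProbabilityMeasure μ]
    (hweak : ∀ g : C(X, ℝ), (∃ B : ℝ, ∀ x, |g x| ≤ B) →
      Tendsto (fun i => ∫ x, g x ∂(μn i)) atTop (𝓝 (∫ x, g x ∂μ)))
    {G : Set X} (hG : IsOpen G) : μ G ≤ atTop.liminf (fun i ↦ μn i G) := by
  let ν : ProbabilityMeasure X := ⟨μ, inferInstance⟩
  let νn : ℕ → ProbabilityMeasure X := fun i => ⟨μn i, inferInstance⟩
  have h : Tendsto νn atTop (𝓝 ν) :=
    ProbabilityMeasure.tendsto_iff_forall_integral_tendsto.2 fun g =>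
      hweak g.toContinuousMap ⟨‖g‖, fun x => g.norm_coe_le_norm x⟩
  exact ProbabilityMeasure.le_liminf_measure_open_of_tendsto h hG

lemma EReal.coe_ennreal_sub_eq_of_add_eq {a k n t l : ℝ≥0∞} (ha : a ≠ ∞) (hk : k ≠ ∞)
    (ht : t ≠ ∞) (h : l + a = k + n + t) : (a : EReal) - n = t + (k + -(l : EReal)) := by
  lift a to NNReal using ha
  lift k to NNReal using hk
  lift t to NNReal using ht
  by_cases hn : n = ∞
  · have hl : l = ∞ := by
      by_contra hl
      exact ENNReal.add_ne_top.2 ⟨hl, ENNReal.coe_ne_top⟩ (h.trans (by rw [hn, add_top, top_add]))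
    simp only [hn, hl, EReal.coe_ennreal_top, EReal.neg_top, EReal.add_bot, sub_eq_add_neg]
  · have hl : l ≠ ∞ := by
      rintro rfl
      refine ENNReal.add_ne_top.2 ⟨ENNReal.add_ne_top.2 ⟨ENNReal.coe_ne_top, hn⟩,
        ENNReal.coe_ne_top⟩ (h.symm.trans (top_add _))
    lift n to NNReal using hn
    lift l to NNReal using hl
    have h' : (l : ℝ) + a = k + n + t := by exact_mod_cast h
    simp only [EReal.coe_nnreal_eq_coe_real, ← EReal.coe_neg, ← EReal.coe_add, ← EReal.coe_sub,
      EReal.coe_eq_coe_iff]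
    linarith

/-- Truncation at level `K`: `f = (f - K)⁺ + (K - (K - f)⁺)` at the level of integrals. -/
lemma integral_posPart_sub_lintegral_negPart_eq {X : Type*} [MeasurableSpace X] {ν : Measure X}
    [IsProbabilityMeasure ν] {f : X → ℝ} (hf : Measurable f)
    (hpos : Integrable (fun x => max (f x) 0) ν) {K : ℝ} (hK : 0 ≤ K) :
    ((∫ x, max (f x) 0 ∂ν : ℝ) : EReal) - ((∫⁻ x, ENNReal.ofReal (-(f x)) ∂ν : ℝ≥0∞) : EReal) =
      ((∫⁻ x, ENNReal.ofReal (f x - K) ∂ν : ℝ≥0∞) : EReal) +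
        (((ENNReal.ofReal K : ℝ≥0∞) : EReal) +
          -((∫⁻ x, ENNReal.ofReal (max (K - f x) 0) ∂ν : ℝ≥0∞) : EReal)) := by
  have hfin : ∫⁻ x, ENNReal.ofReal (max (f x) 0) ∂ν ≠ ∞ := hpos.lintegral_lt_top.ne
  have hcoe : ((∫ x, max (f x) 0 ∂ν : ℝ) : EReal) =
      ((∫⁻ x, ENNReal.ofReal (max (f x) 0) ∂ν : ℝ≥0∞) : EReal) := by
    rw [integral_eq_lintegral_of_nonneg_ae (f := fun x => max (f x) 0) (.of_forall fun x => le_max_right _ _) hpos.1,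
      EReal.coe_ennreal_toReal hfin]
  rw [hcoe]
  refine EReal.coe_ennreal_sub_eq_of_add_eq hfin ENNReal.ofReal_ne_top
    (ne_top_of_le_ne_top hfin (lintegral_mono fun x => ENNReal.ofReal_le_ofReal ?_)) ?_
  · exact (sub_le_self _ hK).trans (le_max_left _ _)
  · have hconst : ENNReal.ofReal K = ∫⁻ _, ENNReal.ofReal K ∂ν := by simp
    rw [hconst, ← lintegral_add_left (by fun_prop), ← lintegral_add_left (by fun_prop),
      ← lintegral_add_left (by fun_prop)]
    refine lintegral_congr fun x => ?_
    have hneg : ENNReal.ofReal (-(f x)) = ENNReal.ofReal (max (-(f x)) 0) := by simp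
    have hsub : ENNReal.ofReal (f x - K) = ENNReal.ofReal (max (f x - K) 0) := by simp
    rw [hneg, hsub, ← ENNReal.ofReal_add (by positivity) (by positivity),
      ← ENNReal.ofReal_add (by positivity) (by positivity),
      ← ENNReal.ofReal_add (by positivity) (by positivity)]
    congr 1
    grind

/-- The excess of `f` over `K ≥ 0` is at most the tail of `f⁺` beyond `K`. -/
lemma lintegral_ofReal_sub_le_setLIntegral {X : Type*} [MeasurableSpace X] (ν : Measure X)
    {f : X → ℝ} (hf : Measurable f) {K : ℝ} (hK : 0 ≤ K) :
    ∫⁻ x, ENNReal.ofReal (f x - K) ∂ν ≤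
      ∫⁻ x in {x | K < max (f x) 0}, ENNReal.ofReal (max (f x) 0) ∂ν := by
  rw [← lintegral_indicator (measurableSet_lt measurable_const (hf.max measurable_const))]
  refine lintegral_mono fun x => ?_
  by_cases hx : K < max (f x) 0
  · rw [Set.indicator_of_mem (by exact hx)]
    exact ENNReal.ofReal_le_ofReal ((sub_le_self _ hK).trans (le_max_left _ _))
  · rw [ENNReal.ofReal_of_nonpos (sub_nonpos.2 ((le_max_left _ _).trans (not_lt.1 hx)))]
    exact zero_le

/-- Let `X` be Polish and `(μₙ)` Borel probability measures converging
weakly to `μ`.  Let `f : X → ℝ` be upper semicontinuous with `f⁺ = max f 0` integrable for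
`μ` and each `μₙ`, and `f⁺` asymptotically uniformly integrable w.r.t. `(μₙ)`.  Then
`limsup_n ∫ f dμₙ ≤ ∫ f dμ`, where `∫ f dν := ∫ f⁺ dν − ∫ f⁻ dν ∈ [−∞, ∞)`. -/
theorem stmt12 {X : Type*} [TopologicalSpace X] [PolishSpace X] [MeasurableSpace X]
    [BorelSpace X]
    (μn : ℕ → Measure X) (μ : Measure X)
    [∀ i, IsProbabilityMeasure (μn i)] [IsProbabilityMeasure μ]
    (hweak : ∀ g : C(X, ℝ), (∃ B : ℝ, ∀ x, |g x| ≤ B) →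
      Tendsto (fun i => ∫ x, g x ∂(μn i)) atTop (𝓝 (∫ x, g x ∂μ)))
    (f : X → ℝ) (hf : UpperSemicontinuous f)
    (hpos : Integrable (fun x => max (f x) 0) μ)
    (hposn : ∀ i, Integrable (fun x => max (f x) 0) (μn i))
    (hUI : Tendsto (fun K : ℝ =>
        Filter.limsup (fun i =>
          ∫⁻ x in {x | K < max (f x) 0}, ENNReal.ofReal (max (f x) 0) ∂(μn i)) atTop)
      atTop (𝓝 (0 : ℝ≥0∞))) :
    Filter.limsup (fun i =>
        ((∫ x, max (f x) 0 ∂(μn i) : ℝ) : EReal) -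
          ((∫⁻ x, ENNReal.ofReal (-(f x)) ∂(μn i) : ℝ≥0∞) : EReal)) atTop
      ≤ ((∫ x, max (f x) 0 ∂μ : ℝ) : EReal) -
          ((∫⁻ x, ENNReal.ofReal (-(f x)) ∂μ : ℝ≥0∞) : EReal) := by
  let := TopologicalSpace.upgradeIsCompletelyMetrizable X
  have hfm : Measurable f := hf.measurable
  have bound : ∀ᶠ K : ℝ in atTop, limsup (fun i =>
        ((∫ x, max (f x) 0 ∂(μn i) : ℝ) : EReal) -
          ((∫⁻ x, ENNReal.ofReal (-(f x)) ∂(μn i) : ℝ≥0∞) : EReal)) atTop ≤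
      ((limsup (fun i => ∫⁻ x in {x | K < max (f x) 0},
        ENNReal.ofReal (max (f x) 0) ∂(μn i)) atTop : ℝ≥0∞) : EReal) +
      (((∫ x, max (f x) 0 ∂μ : ℝ) : EReal) -
          ((∫⁻ x, ENNReal.ofReal (-(f x)) ∂μ : ℝ≥0∞) : EReal)) := by
    filter_upwards [eventually_ge_atTop 0, hUI.eventually_lt_const ENNReal.zero_lt_top]
      with K hK htail
    simp_rw [integral_posPart_sub_lintegral_negPart_eq hfm (hposn _) hK,
      integral_posPart_sub_lintegral_negPart_eq hfm hpos hK]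
    have hcoe (u : ℕ → ℝ≥0∞) : limsup (fun i => (u i : EReal)) atTop = (limsup u atTop : ℝ≥0∞) :=
      (EReal.coe_ennreal_strictMono.monotone.map_limsup_of_continuousAt u
        continuous_coe_ennreal_ereal.continuousAt).symm
    have hcoe' (u : ℕ → ℝ≥0∞) : liminf (fun i => (u i : EReal)) atTop = (liminf u atTop : ℝ≥0∞) :=
      (EReal.coe_ennreal_strictMono.monotone.map_liminf_of_continuousAt u
        continuous_coe_ennreal_ereal.continuousAt).symm
    have hexcess := limsup_le_limsup (f := atTop)
      (.of_forall fun i => lintegral_ofReal_sub_le_setLIntegral (μn i) hfm hK)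
    have hlsc : LowerSemicontinuous fun x => max (K - f x) 0 := by
      intro x y hy
      rcases lt_max_iff.1 hy with hy | hy
      · filter_upwards [hf x (K - y) (by linarith)] with z hz
        exact lt_max_of_lt_left (by linarith)
      · exact .of_forall fun z => lt_max_of_lt_right hy
    have hliminf := lintegral_le_liminf_lintegral_of_lowerSemicontinuous hlsc
      (fun x => le_max_right _ _) fun G hG => measure_le_liminf_of_forall_tendsto_integral hweak hG
    refine (EReal.limsup_add_le (.inl ?_) (.inl ?_)).trans (add_le_add ?_ ?_)
    · rw [hcoe]
      exact EReal.coe_ennreal_ne_bot _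
    · rw [hcoe, Ne, EReal.coe_ennreal_eq_top_iff]
      exact (hexcess.trans_lt htail).ne
    · rw [hcoe]
      exact EReal.coe_ennreal_le_coe_ennreal_iff.2 hexcess
    · refine (EReal.limsup_add_le (.inl ?_) (.inl ?_)).trans ?_
      · simp
      · simp
      rw [limsup_const]
      refine le_trans ?_ (le_add_of_nonneg_left (EReal.coe_ennreal_nonneg _))
      have hneg := EReal.limsup_neg (f := atTop)
        (v := fun i => ((∫⁻ x, ENNReal.ofReal (max (K - f x) 0) ∂(μn i) : ℝ≥0∞) : EReal))
      rw [hcoe'] at hneg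
      refine add_le_add le_rfl (hneg.le.trans ?_)
      exact EReal.neg_le_neg_iff.2 (EReal.coe_ennreal_le_coe_ennreal_iff.2 hliminf)
  have hlim := (continuous_coe_ennreal_ereal.tendsto 0).comp hUI
  rw [EReal.coe_ennreal_zero] at hlim
  refine ge_of_tendsto ?_ bound
  have hadd := (EReal.continuousAt_add (p := (0, ((∫ x, max (f x) 0 ∂μ : ℝ) : EReal) -
    ((∫⁻ x, ENNReal.ofReal (-(f x)) ∂μ : ℝ≥0∞) : EReal))) (by simp) (by simp)).tendsto
  rw [zero_add] at hadd
  exact hadd.comp (hlim.prodMk_nhds tendsto_const_nhds)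
end
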